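/- arXiv:2210.04439 — 5 statements merged into one kernel-verified Lean document; each statement's English description precedes it below -/
import Mathlib

section
/- Let M, N, L be positive integers with L ∣ M and L ∣ N. Set T = lcm(M,N), let e = T if T is odd or T/L is even, and e = 2T otherwise, and define g ∈ ℚ by g = (N·M·L − N·L − M·L − N·M·L/e)/2 + 1 (the genus of the modular curve X_{M,N,L}). Then g = 0 if and only if (M = 1 and L = 1) or (N = 1 and L = 1) or (M = 2 and N = 2), i.e. if and only if (M,N,L) is of the form (M,1,1), (1,N,1), (2,2,1) or (2,2,2). -/
/-- If `M, N ≥ 2` satisfy `(M - 1) * (N - 1) ≤ gcd M N`, then `M = N = 2`. -/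
theorem eq_two_of_pred_mul_pred_le_gcd {M N : ℕ} (hM : 2 ≤ M) (hN : 2 ≤ N)
    (h : (M - 1) * (N - 1) ≤ Nat.gcd M N) : M = 2 ∧ N = 2 := by
  have hdM : Nat.gcd M N ≤ M := Nat.gcd_le_left N (by omega)
  have hdN : Nat.gcd M N ≤ N := Nat.gcd_le_right M (by omega)
  obtain ⟨m, rfl⟩ := Nat.exists_eq_add_of_le hM
  obtain ⟨n, rfl⟩ := Nat.exists_eq_add_of_le hN
  have hm : 2 + m - 1 = m + 1 := by omega
  have hn : 2 + n - 1 = n + 1 := by omega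
  rw [hm, hn] at h
  have hm3 : m ≤ 1 := by nlinarith
  have hn3 : n ≤ 1 := by nlinarith
  interval_cases m <;> interval_cases n <;> simp_all

/-- The genus `g = (NML − NL − ML − NML/e)/2 + 1` of the modular curve
`X_{M,N,L}` (where `T = lcm(M,N)` and `e = T` if `T` is odd or `T/L` is even,
`e = 2T` otherwise) is `0` if and only if `(M,N,L)` is of the form `(M,1,1)`,
`(1,N,1)`, `(2,2,1)` or `(2,2,2)`. -/
theorem genus_eq_zero_iff (M N L : ℕ) (hM : 0 < M) (hN : 0 < N) (hL : 0 < L)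
    (hLM : L ∣ M) (hLN : L ∣ N)
    (T e : ℕ) (hT : T = Nat.lcm M N)
    (he : e = if Odd T ∨ Even (T / L) then T else 2 * T)
    (g : ℚ)
    (hg : g = ((N : ℚ) * M * L - N * L - M * L - N * M * L / e) / 2 + 1) :
    g = 0 ↔ (M = 1 ∧ L = 1) ∨ (N = 1 ∧ L = 1) ∨ (M = 2 ∧ N = 2) := by
  have hT0 : 0 < T := hT ▸ Nat.lcm_pos hM hN
  have hTQ : (T : ℚ) ≠ 0 := by positivity
  have hmul : (Nat.gcd M N : ℚ) * T = M * N := by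
    rw [hT]; exact_mod_cast Nat.gcd_mul_lcm M N
  constructor
  · intro h0
    by_cases hM1 : M = 1
    · exact Or.inl ⟨hM1, Nat.dvd_one.mp (hM1 ▸ hLM)⟩
    by_cases hN1 : N = 1
    · exact Or.inr (Or.inl ⟨hN1, Nat.dvd_one.mp (hN1 ▸ hLN)⟩)
    refine Or.inr (Or.inr
      (eq_two_of_pred_mul_pred_le_gcd (by omega) (by omega) ?_))
    have heT : T ≤ e := by rw [he]; split_ifs <;> omega
    have hquot : (N : ℚ) * M * L / e ≤ Nat.gcd M N * L := by
      have hTe : (T : ℚ) ≤ e := by exact_mod_cast heT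
      rw [div_le_iff₀ (by exact_mod_cast hT0.trans_le heT)]
      calc (N : ℚ) * M * L = Nat.gcd M N * L * T := by linear_combination -(L : ℚ) * hmul
        _ ≤ Nat.gcd M N * L * e := by gcongr
    have hlt : (L : ℚ) * ((M - 1) * (N - 1)) < L * (Nat.gcd M N + 1) := by linarith
    have hlt' := lt_of_mul_lt_mul_left hlt (by positivity)
    rw [← Nat.lt_succ_iff, ← Nat.cast_lt (α := ℚ)]
    push_cast [Nat.cast_sub hM, Nat.cast_sub hN]
    exact hlt'
  · have hL1 (h : L = 1) : e = T := by
      rw [he, h, Nat.div_one, if_pos (Nat.even_or_odd T).symm]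
    rintro (⟨rfl, rfl⟩ | ⟨rfl, rfl⟩ | ⟨rfl, rfl⟩)
    · obtain rfl : T = N := by simpa using hT
      rw [hg, hL1 rfl]
      field_simp
      push_cast
      ring
    · obtain rfl : T = M := by simpa using hT
      rw [hg, hL1 rfl]
      field_simp
      push_cast
      ring
    · obtain rfl : T = 2 := by simpa using hT
      have hL2 : L ≤ 2 := Nat.le_of_dvd (by norm_num) hLM
      interval_cases L
      · rw [hg, hL1 rfl]
        norm_num
      · have he4 : e = 4 := by rw [he, if_neg (by decide)]
        rw [hg, he4]
        norm_num
end

section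
/- Let M, N, L be positive integers with L ∣ M and L ∣ N. Set T = lcm(M,N), let e = T if T is odd or T/L is even, and e = 2T otherwise, and define g ∈ ℚ by g = (N·M·L − N·L − M·L − N·M·L/e)/2 + 1 (the genus of the modular curve X_{M,N,L}). Then g = 1 if and only if {M,N} = {2,3}, or {M,N} = {2,4}, or M = N = 3; i.e. if and only if, up to exchanging M and N, (M,N,L) is one of (3,2,1), (4,2,1), (4,2,2), (3,3,1), (3,3,3). -/
/-- If `1/m + 1/n + 1/e = 1` (with denominators cleared) and `n ≤ e`, then `n ≤ 4`. -/
lemma le_four_of_mul_mul_eq {m n e : ℕ} (hm : 0 < m) (hn : 0 < n) (hne : n ≤ e)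
    (h : n * m * e = n * e + m * e + n * m) : n ≤ 4 := by
  by_contra! hn5
  have hm2 : 2 ≤ m := by
    by_contra! hm2
    obtain rfl : m = 1 := by omega
    nlinarith
  obtain ⟨a, rfl⟩ := Nat.exists_eq_add_of_le hm2
  obtain ⟨b, rfl⟩ := Nat.exists_eq_add_of_le (show 5 ≤ n from hn5)
  nlinarith [Nat.mul_le_mul_left (2 + a) hne, Nat.zero_le (a * b * e), Nat.zero_le (a * e),
    Nat.zero_le (b * e)]


/-- The genus `g = (NML − NL − ML − NML/e)/2 + 1` of the modular curve
`X_{M,N,L}` (where `T = lcm(M,N)` and `e = T` if `T` is odd or `T/L` is even,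
`e = 2T` otherwise) is `1` if and only if `{M,N} = {2,3}`, or `{M,N} = {2,4}`,
or `M = N = 3`. -/
theorem genus_eq_one_iff (M N L : ℕ) (hM : 0 < M) (hN : 0 < N) (hL : 0 < L)
    (hLM : L ∣ M) (hLN : L ∣ N)
    (T e : ℕ) (hT : T = Nat.lcm M N)
    (he : e = if Odd T ∨ Even (T / L) then T else 2 * T)
    (g : ℚ)
    (hg : g = ((N : ℚ) * M * L - N * L - M * L - N * M * L / e) / 2 + 1) :
    g = 1 ↔ (M = 2 ∧ N = 3) ∨ (M = 3 ∧ N = 2) ∨ (M = 2 ∧ N = 4) ∨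
      (M = 4 ∧ N = 2) ∨ (M = 3 ∧ N = 3) := by
  have hTM : M ∣ T := hT ▸ Nat.dvd_lcm_left M N
  have hTN : N ∣ T := hT ▸ Nat.dvd_lcm_right M N
  have hTpos : 0 < T := hT ▸ Nat.lcm_pos hM hN
  have hTe : T ≤ e := by
    rw [he]
    split_ifs <;> omega
  have hMe : M ≤ e := (Nat.le_of_dvd hTpos hTM).trans hTe
  have hNe : N ≤ e := (Nat.le_of_dvd hTpos hTN).trans hTe
  have hL0 : (L : ℚ) ≠ 0 := by positivity
  have he0 : (e : ℚ) ≠ 0 := by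
    have : 0 < e := hTpos.trans_le hTe
    positivity
  have key : g = 1 ↔ N * M * e = N * e + M * e + N * M := by
    have hfac : g - 1 = L * (N * M * e - (N * e + M * e + N * M)) / (2 * e) := by
      rw [hg]
      field_simp
      ring
    rw [← sub_eq_zero, hfac, div_eq_zero_iff, mul_eq_zero, sub_eq_zero]
    simp only [hL0, he0, mul_eq_zero, OfNat.ofNat_ne_zero, false_or, or_false]
    norm_cast
  have hLM' : L ≤ M := Nat.le_of_dvd hM hLM
  have bounds : g = 1 → M ≤ 4 ∧ N ≤ 4 := fun h =>
    ⟨le_four_of_mul_mul_eq hN hM hMe (by linarith [key.1 h]),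
      le_four_of_mul_mul_eq hM hN hNe (key.1 h)⟩
  by_cases hb : M ≤ 4 ∧ N ≤ 4
  · rw [key]
    clear key bounds hg hTM hTN hTe hMe hNe hTpos he0 hL0
    obtain ⟨hM4, hN4⟩ := hb
    subst he hT
    interval_cases M <;> interval_cases N <;> interval_cases L <;> revert hLM hLN <;> decide
  · exact ⟨fun h => absurd (bounds h) hb, by omega⟩
end

section
/- Let p be a prime with p ≥ 5. Let Γ(2) be the kernel of the reduction homomorphism SL₂(ℤ) → SL₂(ℤ/2ℤ), let D = ⁅Γ(2),Γ(2)⁆ be its commutator subgroup, and let red_p : SL₂(ℤ) → SL₂(ℤ/pℤ) be reduction modulo p. Then the subgroup of SL₂(ℤ/pℤ) generated by red_p(D) together with −1 (the negative of the identity matrix) is all of SL₂(ℤ/pℤ). Equivalently, the image of the commutator subgroup of Γ̄(2) = Γ(2)/{±1} in PSL₂(ℤ/pℤ) is the whole group. -/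
/-- Reduction modulo `n` on `SL₂(ℤ)`. -/
def SL2Red (n : ℕ) :
    Matrix.SpecialLinearGroup (Fin 2) ℤ →* Matrix.SpecialLinearGroup (Fin 2) (ZMod n) :=
  Matrix.SpecialLinearGroup.map (Int.castRingHom (ZMod n))

/-- The principal congruence subgroup `Γ(2)` of `SL₂(ℤ)`. -/
def GammaTwo : Subgroup (Matrix.SpecialLinearGroup (Fin 2) ℤ) := (SL2Red 2).ker

instance : Fact (Even (Fintype.card (Fin 2))) := ⟨by simp⟩

open Matrix.SpecialLinearGroup in
theorem SL2Red_transvection (n : ℕ) {i j : Fin 2} (hij : i ≠ j) (b : ℤ) :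
    SL2Red n (transvection hij b) = transvection hij (b : ZMod n) := by
  ext k l
  change Int.castRingHom (ZMod n) (transvection hij b k l) = _
  rw [transvection_coe, transvection_coe, Matrix.add_apply, Matrix.add_apply,
    Matrix.one_apply, Matrix.one_apply, Matrix.single_apply, Matrix.single_apply]
  split_ifs <;> simp

/-- Reduction modulo an odd prime maps `Γ(2)` onto `SL₂(ℤ/p)`. -/
theorem map_SL2Red_GammaTwo_eq_top (p : ℕ) [Fact p.Prime] (h2 : (2 : ZMod p) ≠ 0) :
    GammaTwo.map (SL2Red p) = ⊤ := by
  refine eq_top_iff.2 fun M _ ↦ Matrix.SL2.transvection_induction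
    (· ∈ GammaTwo.map (SL2Red p)) (fun i j hij a ↦ ?_) (fun _ _ ↦ mul_mem) M
  obtain ⟨k, hk⟩ := ZMod.intCast_surjective (a / 2)
  refine ⟨Matrix.SpecialLinearGroup.transvection hij (2 * k), ?_, ?_⟩
  · have h0 : (2 : ZMod 2) = 0 := rfl
    simp [GammaTwo, MonoidHom.mem_ker, SL2Red_transvection, h0,
      Matrix.SpecialLinearGroup.transvection_coeff_zero]
  · simp [SL2Red_transvection, hk, mul_div_cancel₀ _ h2]


/-- For a prime `p ≥ 5`, the subgroup of `SL₂(ℤ/p)` generated by the image of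
the commutator subgroup `D = ⁅Γ(2),Γ(2)⁆` under reduction modulo `p`, together
with `-1`, is all of `SL₂(ℤ/p)`; equivalently, the image of the commutator
subgroup of `Γ̄(2) = Γ(2)/{±1}` in `PSL₂(ℤ/p)` is the whole group. -/
theorem closure_image_commutator_gamma2_mod_p (p : ℕ) (hp : p.Prime) (hp5 : 5 ≤ p) :
    Subgroup.closure
      ((SL2Red p) '' (⁅GammaTwo, GammaTwo⁆ :
          Subgroup (Matrix.SpecialLinearGroup (Fin 2) ℤ)) ∪ {-1}) = ⊤ := by
  have : Fact p.Prime := ⟨hp⟩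
  have h2 : (2 : ZMod p) ≠ 0 := fun h ↦ by
    have := Nat.le_of_dvd two_pos ((ZMod.natCast_eq_zero_iff 2 p).1 (by exact_mod_cast h))
    omega
  have h3 : (3 : ZMod p) ≠ 0 := fun h ↦ by
    have := Nat.le_of_dvd three_pos ((ZMod.natCast_eq_zero_iff 3 p).1 (by exact_mod_cast h))
    omega
  have hD : (⁅GammaTwo, GammaTwo⁆).map (SL2Red p) = ⊤ := by
    rw [Subgroup.map_commutator, map_SL2Red_GammaTwo_eq_top p h2, ← commutator_def]
    exact Matrix.SL2.commutator_eq_top h2 fun h ↦ h3 (by linear_combination h)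
  refine eq_top_iff.2 fun M _ ↦ Subgroup.subset_closure (Or.inl ?_)
  rw [← Subgroup.coe_map, hD]
  exact Subgroup.mem_top M
end

section
/- Let Γ(2) be the kernel of the reduction homomorphism SL₂(ℤ) → SL₂(ℤ/2ℤ), let D = ⁅Γ(2),Γ(2)⁆ be its commutator subgroup, and let red₃ : SL₂(ℤ) → SL₂(ℤ/3ℤ) be reduction modulo 3. Then the subgroup of SL₂(ℤ/3ℤ) generated by red₃(D) together with −1 is the order-8 subgroup {±I, ±[[0,-1],[1,0]], ±[[-1,1],[1,1]], ±[[1,1],[1,-1]]}; in particular it has index 3 in SL₂(ℤ/3ℤ). Equivalently, the image of the commutator subgroup of Γ̄(2) = Γ(2)/{±1} in PSL₂(ℤ/3ℤ) is the 2-Sylow subgroup D₃ of PSL₂(ℤ/3ℤ). -/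
/-- The set of elements of `SL₂(ℤ/3)` that are central or have trace zero is a subgroup. -/
def centralOrTraceZero : Subgroup (Matrix.SpecialLinearGroup (Fin 2) (ZMod 3)) where
  carrier := {g | g = 1 ∨ g = -1 ∨ (g : Matrix (Fin 2) (Fin 2) (ZMod 3)).trace = 0}
  one_mem' := Or.inl rfl
  mul_mem' {a b} ha hb := by
    revert a b
    simp only [Set.mem_ofPred_eq]
    decide +kernel
  inv_mem' {a} ha := by
    revert a
    simp only [Set.mem_ofPred_eq]
    decide +kernel

theorem mem_centralOrTraceZero {g : Matrix.SpecialLinearGroup (Fin 2) (ZMod 3)} :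
    g ∈ centralOrTraceZero ↔
      g = 1 ∨ g = -1 ∨ (g : Matrix (Fin 2) (Fin 2) (ZMod 3)).trace = 0 :=
  Iff.rfl

open scoped commutatorElement in
theorem commutatorElement_mem_centralOrTraceZero
    (g h : Matrix.SpecialLinearGroup (Fin 2) (ZMod 3)) : ⁅g, h⁆ ∈ centralOrTraceZero := by
  rw [mem_centralOrTraceZero]
  revert g h
  decide +kernel

theorem index_centralOrTraceZero : centralOrTraceZero.index = 3 := by
  have hG : Nat.card (Matrix.SpecialLinearGroup (Fin 2) (ZMod 3)) = 24 := by
    rw [Nat.card_eq_fintype_card]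
    decide +kernel
  have hK : Nat.card centralOrTraceZero = 8 := by
    change Nat.card {g : Matrix.SpecialLinearGroup (Fin 2) (ZMod 3) //
      g = 1 ∨ g = -1 ∨ (g : Matrix (Fin 2) (Fin 2) (ZMod 3)).trace = 0} = 8
    rw [Nat.card_eq_fintype_card]
    decide +kernel
  have := centralOrTraceZero.card_mul_index
  rw [hG, hK] at this
  omega

/-- The order-four element `[[0, -1], [1, 0]]` of `SL₂(ℤ/3)`. -/
def quaternionI : Matrix.SpecialLinearGroup (Fin 2) (ZMod 3) := ⟨!![0, -1; 1, 0], by decide⟩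

/-- The order-four element `[[-1, 1], [1, 1]]` of `SL₂(ℤ/3)`. -/
def quaternionJ : Matrix.SpecialLinearGroup (Fin 2) (ZMod 3) := ⟨!![-1, 1; 1, 1], by decide⟩

/-- The order-four element `[[1, 1], [1, -1]]` of `SL₂(ℤ/3)`. -/
def quaternionK : Matrix.SpecialLinearGroup (Fin 2) (ZMod 3) := ⟨!![1, 1; 1, -1], by decide⟩

theorem mem_centralOrTraceZero_iff_eq {g : Matrix.SpecialLinearGroup (Fin 2) (ZMod 3)} :
    g ∈ centralOrTraceZero ↔ g = 1 ∨ g = -1 ∨ g = quaternionI ∨ g = -quaternionI ∨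
      g = quaternionJ ∨ g = -quaternionJ ∨ g = quaternionK ∨ g = -quaternionK := by
  rw [mem_centralOrTraceZero]
  revert g
  decide +kernel

theorem centralOrTraceZero_le {H : Subgroup (Matrix.SpecialLinearGroup (Fin 2) (ZMod 3))}
    (h_neg : -1 ∈ H) (hI : quaternionI ∈ H) (hJ : quaternionJ ∈ H) :
    centralOrTraceZero ≤ H := by
  have neg_mem {x : Matrix.SpecialLinearGroup (Fin 2) (ZMod 3)} (hx : x ∈ H) : -x ∈ H := by
    rw [← neg_one_mul]
    exact H.mul_mem h_neg hx
  have hK : quaternionK ∈ H := by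
    rw [show quaternionK = -(quaternionI * quaternionJ) by decide +kernel]
    exact neg_mem (H.mul_mem hI hJ)
  intro g hg
  rcases mem_centralOrTraceZero_iff_eq.1 hg with rfl | rfl | rfl | rfl | rfl | rfl | rfl | rfl
  exacts [H.one_mem, h_neg, hI, neg_mem hI, hJ, neg_mem hJ, hK, neg_mem hK]

open scoped commutatorElement in
theorem closure_image_commutator_gammaTwo_eq :
    Subgroup.closure
        ((SL2Red 3) '' (⁅GammaTwo, GammaTwo⁆ :
            Subgroup (Matrix.SpecialLinearGroup (Fin 2) ℤ)) ∪ {-1}) = centralOrTraceZero := by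
  apply le_antisymm
  · rw [Subgroup.closure_le, Set.union_subset_iff, Set.singleton_subset_iff]
    refine ⟨?_, Or.inr (Or.inl rfl)⟩
    have h : (⁅GammaTwo, GammaTwo⁆ : Subgroup (Matrix.SpecialLinearGroup (Fin 2) ℤ)) ≤
        centralOrTraceZero.comap (SL2Red 3) := by
      rw [Subgroup.commutator_le]
      intro a _ b _
      rw [Subgroup.mem_comap, map_commutatorElement]
      exact commutatorElement_mem_centralOrTraceZero _ _
    exact Set.image_subset_iff.2 h
  · let A : Matrix.SpecialLinearGroup (Fin 2) ℤ := ⟨!![1, 2; 0, 1], by simp⟩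
    let B : Matrix.SpecialLinearGroup (Fin 2) ℤ := ⟨!![1, 0; 2, 1], by simp⟩
    have hA : A ∈ GammaTwo := by
      change SL2Red 2 A = 1
      decide +kernel
    have hB : B ∈ GammaTwo := by
      change SL2Red 2 B = 1
      decide +kernel
    refine centralOrTraceZero_le (Subgroup.subset_closure (Or.inr rfl))
      (Subgroup.subset_closure
        (Or.inl ⟨⁅B, A⁆, Subgroup.commutator_mem_commutator hB hA, ?_⟩))
      (Subgroup.subset_closure
        (Or.inl ⟨⁅B⁻¹, A⁆, Subgroup.commutator_mem_commutator (inv_mem hB) hA, ?_⟩))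
    · decide +kernel
    · decide +kernel

/-- The subgroup of `SL₂(ℤ/3)` generated by the image of the commutator
subgroup `D = ⁅Γ(2),Γ(2)⁆` under reduction modulo `3`, together with `-1`, is
the order-8 subgroup `{±I, ±[[0,-1],[1,0]], ±[[-1,1],[1,1]], ±[[1,1],[1,-1]]}`;
in particular it has index `3` in `SL₂(ℤ/3)`.  Equivalently, the image of the
commutator subgroup of `Γ̄(2)` in `PSL₂(ℤ/3)` is the 2-Sylow subgroup `D₃`. -/
theorem closure_image_commutator_gamma2_mod_three
    (S U V : Matrix.SpecialLinearGroup (Fin 2) (ZMod 3))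
    (hS : (S : Matrix (Fin 2) (Fin 2) (ZMod 3)) = !![0, -1; 1, 0])
    (hU : (U : Matrix (Fin 2) (Fin 2) (ZMod 3)) = !![-1, 1; 1, 1])
    (hV : (V : Matrix (Fin 2) (Fin 2) (ZMod 3)) = !![1, 1; 1, -1]) :
    (Subgroup.closure
        ((SL2Red 3) '' (⁅GammaTwo, GammaTwo⁆ :
            Subgroup (Matrix.SpecialLinearGroup (Fin 2) ℤ)) ∪ {-1}) :
        Set (Matrix.SpecialLinearGroup (Fin 2) (ZMod 3))) =
      {1, -1, S, -S, U, -U, V, -V} ∧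
    (Subgroup.closure
        ((SL2Red 3) '' (⁅GammaTwo, GammaTwo⁆ :
            Subgroup (Matrix.SpecialLinearGroup (Fin 2) ℤ)) ∪ {-1})).index = 3 := by
  rw [closure_image_commutator_gammaTwo_eq]
  refine ⟨?_, index_centralOrTraceZero⟩
  obtain rfl : S = quaternionI := Subtype.ext hS
  obtain rfl : U = quaternionJ := Subtype.ext hU
  obtain rfl : V = quaternionK := Subtype.ext hV
  ext g
  exact mem_centralOrTraceZero_iff_eq
end

section
/- Let N ≥ 3 be an odd integer, let K be a field, and let ζ ∈ K be a primitive N-th root of unity. Then ∏_{i=1}^{(N-1)/2} ((ζ^i − 1)/(ζ^{-i} − 1))^i = (−1)^{(N²−1)/8} · ζ^{N(N²−1)/24}. (For N odd, (N²−1)/8 and N(N²−1)/24 are integers.) -/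
theorem pow_sub_one_div_zpow_neg_sub_one {K : Type*} [Field K] {ζ : K} (h0 : ζ ≠ 0) {i : ℕ}
    (h : ζ ^ i ≠ 1) : (ζ ^ i - 1) / (ζ ^ (-(i : ℤ)) - 1) = -ζ ^ i := by
  have hi : ζ ^ i ≠ 0 := pow_ne_zero i h0
  have hinv : (ζ ^ i)⁻¹ - 1 ≠ 0 := by
    rw [sub_ne_zero]
    simpa using h
  rw [zpow_neg, zpow_natCast, div_eq_iff hinv, mul_sub, neg_mul, mul_inv_cancel₀ hi]
  ring

theorem sum_Icc_one_id_mul_two (m : ℕ) : (∑ i ∈ Finset.Icc 1 m, i) * 2 = m * (m + 1) := by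
  induction m with
  | zero => simp
  | succ k ih =>
    rw [Finset.sum_Icc_succ_top (by omega), add_mul, ih]
    ring

theorem sum_Icc_one_mul_self_mul_six (m : ℕ) :
    (∑ i ∈ Finset.Icc 1 m, i * i) * 6 = m * (m + 1) * (2 * m + 1) := by
  induction m with
  | zero => simp
  | succ k ih =>
    rw [Finset.sum_Icc_succ_top (by omega), add_mul, ih]
    ring

/-- Let `N ≥ 3` be odd, `K` a field and `ζ ∈ K` a primitive `N`-th root of
unity.  Then `∏_{i=1}^{(N-1)/2} ((ζ^i − 1)/(ζ^{-i} − 1))^i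
= (−1)^{(N²−1)/8} ζ^{N(N²−1)/24}`. -/
theorem cusp_value_product {K : Type*} [Field K]
    (N : ℕ) (hN : 3 ≤ N) (hNodd : Odd N) (ζ : K) (hζ : IsPrimitiveRoot ζ N) :
    ∏ i ∈ Finset.Icc 1 ((N - 1) / 2), ((ζ ^ i - 1) / (ζ ^ (-(i : ℤ)) - 1)) ^ i =
      (-1 : K) ^ ((N ^ 2 - 1) / 8) * ζ ^ (N * (N ^ 2 - 1) / 24) := by
  have h0 : ζ ≠ 0 := hζ.ne_zero (by omega)
  obtain ⟨m, rfl⟩ := hNodd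
  have hm : (2 * m + 1 - 1) / 2 = m := by omega
  have hsq : (2 * m + 1) ^ 2 - 1 = 4 * (m * (m + 1)) := by
    rw [Nat.sub_eq_iff_eq_add (Nat.one_le_pow _ _ (by omega))]
    ring
  have hsum : ((2 * m + 1) ^ 2 - 1) / 8 = ∑ i ∈ Finset.Icc 1 m, i := by
    rw [hsq, ← sum_Icc_one_id_mul_two]
    omega
  have hsumsq : (2 * m + 1) * ((2 * m + 1) ^ 2 - 1) / 24 = ∑ i ∈ Finset.Icc 1 m, i * i := by
    rw [hsq, show (2 * m + 1) * (4 * (m * (m + 1))) = 4 * (m * (m + 1) * (2 * m + 1)) by ring,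
      ← sum_Icc_one_mul_self_mul_six]
    omega
  rw [hm, hsum, hsumsq, ← Finset.prod_pow_eq_pow_sum, ← Finset.prod_pow_eq_pow_sum,
    ← Finset.prod_mul_distrib]
  refine Finset.prod_congr rfl fun i hi => ?_
  rw [Finset.mem_Icc] at hi
  rw [pow_sub_one_div_zpow_neg_sub_one h0 (hζ.pow_ne_one_of_pos_of_lt (by omega) (by omega)),
    neg_pow, ← pow_mul]
end
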